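/- (Pfaff transformation.) Let α, β, γ be multiplicative characters of κ with α ≠ ε, α ≠ γ, β ≠ ε and β ≠ γ. Then for every λ ∈ κ with λ ≠ 1: F(α,β; γ; λ) = ᾱ(1−λ) · F(α, β̄γ; γ; λ/(λ−1)). -/

import Mathlib

/-!
Finite-field hypergeometric functions (Otsubo), basic definitions:
`κ` is a finite field with `q = Fintype.card κ` elements, `ψ` a fixed nontrivial
additive character, multiplicative characters are `MulChar κ ℂ` (extended by `0`
on `0`, with trivial character `1`).
-/

open scoped Classical

noncomputable section

variable {κ : Type*} [Field κ] [Fintype κ]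

instance : Fintype (MulChar κ ℂ) := Fintype.ofFinite _

/-- The Gauss sum `g(φ) = -∑_{x ∈ κ} ψ(x) φ(x)`. -/
def gS (ψ : AddChar κ ℂ) (φ : MulChar κ ℂ) : ℂ := -∑ x : κ, ψ x * φ x

/-- The variant `g°(φ) = q^{δ(φ)} · g(φ)`, where `δ(φ) = 1` iff `φ` is trivial. -/
def gSo (ψ : AddChar κ ℂ) (φ : MulChar κ ℂ) : ℂ :=
  (if φ = 1 then (Fintype.card κ : ℂ) else 1) * gS ψ φ

/-- The Pochhammer symbol `(α)_ν = g(αν)/g(α)`. -/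
def poch (ψ : AddChar κ ℂ) (α ν : MulChar κ ℂ) : ℂ := gS ψ (α * ν) / gS ψ α

/-- The variant Pochhammer symbol `(α)°_ν = g°(αν)/g°(α)`. -/
def pocho (ψ : AddChar κ ℂ) (α ν : MulChar κ ℂ) : ℂ := gSo ψ (α * ν) / gSo ψ α

/-- The finite hypergeometric function
`F(α₁,…,α_r; β₁,…,β_s; λ) = (1/(1-q)) ∑_ν ((α₁)_ν ⋯ (α_r)_ν / ((ε)°_ν (β₁)°_ν ⋯ (β_s)°_ν)) ν(λ)`
(the trivial character `ε = 1` appears implicitly among the lower parameters). -/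
def Fh (ψ : AddChar κ ℂ) {r s : ℕ} (A : Fin r → MulChar κ ℂ) (B : Fin s → MulChar κ ℂ)
    (l : κ) : ℂ :=
  (1 - (Fintype.card κ : ℂ))⁻¹ *
    ∑ ν : MulChar κ ℂ,
      ((∏ i, poch ψ (A i) ν) / (pocho ψ 1 ν * ∏ j, pocho ψ (B j) ν)) * ν l

lemma MulChar.sum_apply_eq_ite (x : κ) :
    ∑ ν : MulChar κ ℂ, ν x = if x = 1 then (Fintype.card κ : ℂ) - 1 else 0 := by
  split_ifs with hx
  · have hcard : Fintype.card (MulChar κ ℂ) + 1 = Fintype.card κ := by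
      rw [← Nat.card_eq_fintype_card (α := MulChar κ ℂ),
        MulChar.card_eq_card_units_of_hasEnoughRootsOfUnity, Nat.card_eq_fintype_card,
        Fintype.card_units]
      exact Nat.sub_add_cancel Fintype.card_pos
    rw [← hcard]
    simp [hx]
  · obtain ⟨χ, hχ⟩ := MulChar.exists_apply_ne_one_of_hasEnoughRootsOfUnity κ ℂ hx
    refine eq_zero_of_mul_eq_self_left hχ ?_
    simp only [Finset.mul_sum, ← MulChar.mul_apply]
    exact Fintype.sum_bijective _ (Group.mulLeft_bijective χ) _ _ fun _ ↦ rfl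

lemma gS_eq_neg_gaussSum (ψ : AddChar κ ℂ) (φ : MulChar κ ℂ) : gS ψ φ = -gaussSum φ ψ := by
  simp [gS, gaussSum, mul_comm]

lemma gS_one {ψ : AddChar κ ℂ} (hψ : ψ ≠ 1) : gS ψ 1 = 1 := by
  rw [gS_eq_neg_gaussSum, gaussSum_one_left hψ, neg_neg]

lemma gS_ne_zero {ψ : AddChar κ ℂ} (hψ : ψ ≠ 1) (φ : MulChar κ ℂ) : gS ψ φ ≠ 0 := by
  by_cases hφ : φ = 1
  · simp [hφ, gS_one hψ]
  · rw [gS_eq_neg_gaussSum, neg_ne_zero]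
    exact gaussSum_ne_zero_of_nontrivial (by simp) hφ (AddChar.IsPrimitive.of_ne_one hψ)

lemma gSo_ne_zero {ψ : AddChar κ ℂ} (hψ : ψ ≠ 1) (φ : MulChar κ ℂ) : gSo ψ φ ≠ 0 := by
  refine mul_ne_zero ?_ (gS_ne_zero hψ φ)
  split_ifs <;> simp

lemma gS_mul_gS {ψ : AddChar κ ℂ} (hψ : ψ ≠ 1) (χ : MulChar κ ℂ) {φ : MulChar κ ℂ}
    (hφ : φ ≠ 1) : gS ψ χ * gS ψ φ = -jacobiSum χ φ * gSo ψ (χ * φ) := by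
  by_cases h : χ * φ = 1
  · obtain rfl : χ = φ⁻¹ := eq_inv_of_mul_eq_one_left h
    have hcard := gaussSum_mul_gaussSum_eq_card hφ (AddChar.IsPrimitive.of_ne_one hψ)
    have hinv := mul_gaussSum_inv_eq_gaussSum φ⁻¹ ψ
    have hneg : φ⁻¹ (-1) = φ (-1) := by simp [MulChar.inv_apply']
    rw [jacobiSum_comm, jacobiSum_nontrivial_inv hφ, gSo, if_pos h, h, gS_one hψ,
      gS_eq_neg_gaussSum, gS_eq_neg_gaussSum, ← hinv, hneg, ← hcard]
    ring
  · have hmul := jacobiSum_mul_nontrivial h ψ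
    rw [gSo, if_neg h]
    simp only [gS_eq_neg_gaussSum]
    linear_combination -hmul

lemma poch_div_pocho {ψ : AddChar κ ℂ} (hψ : ψ ≠ 1) {α γ : MulChar κ ℂ} (h : α ≠ γ)
    (ν : MulChar κ ℂ) :
    poch ψ α ν / pocho ψ γ ν =
      -gSo ψ γ / (gS ψ α * gS ψ (α⁻¹ * γ)) * jacobiSum (α * ν) (α⁻¹ * γ) := by
  have hne : α⁻¹ * γ ≠ 1 := by rwa [ne_eq, inv_mul_eq_one]
  have key := gS_mul_gS hψ (α * ν) hne
  rw [show α * ν * (α⁻¹ * γ) = γ * ν by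
    rw [mul_mul_mul_comm, mul_inv_cancel, one_mul, mul_comm]] at key
  have h₁ := gS_ne_zero hψ α
  have h₂ := gS_ne_zero hψ (α⁻¹ * γ)
  have h₃ := gSo_ne_zero hψ γ
  have h₄ := gSo_ne_zero hψ (γ * ν)
  rw [poch, pocho]
  field_simp
  linear_combination key

lemma sum_jacobiSum_mul_jacobiSum_mul (a b c d : MulChar κ ℂ) (l : κ) :
    ∑ ν : MulChar κ ℂ, jacobiSum (a * ν) c * jacobiSum (b * ν) d * ν l =
      ((Fintype.card κ : ℂ) - 1) *
        ∑ t : κ, a (t * l)⁻¹ * c (1 - (t * l)⁻¹) * (b t * d (1 - t)) := by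
  calc
    _ = ∑ ν : MulChar κ ℂ, ∑ t : κ, ∑ s : κ,
          a s * c (1 - s) * (b t * d (1 - t)) * ν (s * (t * l)) := by
      refine Finset.sum_congr rfl fun ν _ ↦ ?_
      rw [jacobiSum, jacobiSum, Finset.sum_mul_sum, Finset.sum_comm, Finset.sum_mul]
      refine Finset.sum_congr rfl fun t _ ↦ ?_
      rw [Finset.sum_mul]
      refine Finset.sum_congr rfl fun s _ ↦ ?_
      simp only [MulChar.mul_apply, map_mul]
      ring
    _ = ∑ t : κ, ∑ s : κ, a s * c (1 - s) * (b t * d (1 - t)) *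
          ∑ ν : MulChar κ ℂ, ν (s * (t * l)) := by
      rw [Finset.sum_comm]
      refine Finset.sum_congr rfl fun t _ ↦ ?_
      rw [Finset.sum_comm]
      simp only [Finset.mul_sum]
    _ = _ := by
      rw [Finset.mul_sum]
      refine Finset.sum_congr rfl fun t _ ↦ ?_
      simp only [MulChar.sum_apply_eq_ite]
      by_cases h : t * l = 0
      · simp [h, MulChar.map_zero]
      · simp only [mul_eq_one_iff_eq_inv₀ h, mul_ite, mul_zero, Finset.sum_ite_eq',
          Finset.mem_univ, if_true]
        ring

lemma MulChar.inv_mul_inv_one_sub_inv {F : Type*} [Field F] (a : MulChar F ℂ)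
    {u : F} (hu : u ≠ 0) :
    a u⁻¹ * a⁻¹ (1 - u⁻¹) = a⁻¹ (u - 1) := by
  rw [← MulChar.inv_apply', ← map_mul]
  congr 1
  field_simp

lemma Fh_eq_sum {ψ : AddChar κ ℂ} (hψ : ψ ≠ 1) {α β γ : MulChar κ ℂ} (hα : α ≠ 1)
    (hβ : β ≠ γ) {l : κ} (hl : l ≠ 0) :
    Fh ψ ![α, β] ![γ] l =
      -(gSo ψ 1 / (gS ψ α * gS ψ α⁻¹) * (gSo ψ γ / (gS ψ β * gS ψ (β⁻¹ * γ)))) *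
        ∑ t : κ, α⁻¹ (t * l - 1) * (β t * (β⁻¹ * γ) (1 - t)) := by
  have hq : (1 - (Fintype.card κ : ℂ)) ≠ 0 := by
    rw [sub_ne_zero]
    exact_mod_cast (Fintype.one_lt_card (α := κ)).ne
  have hterm (ν : MulChar κ ℂ) :
      (∏ i, poch ψ (![α, β] i) ν) / (pocho ψ 1 ν * ∏ j, pocho ψ (![γ] j) ν) * ν l =
        gSo ψ 1 / (gS ψ α * gS ψ α⁻¹) * (gSo ψ γ / (gS ψ β * gS ψ (β⁻¹ * γ))) *
          (jacobiSum (α * ν) α⁻¹ * jacobiSum (β * ν) (β⁻¹ * γ) * ν l) := by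
    simp only [Fin.prod_univ_two, Fin.prod_univ_one, Matrix.cons_val_zero, Matrix.cons_val_one]
    rw [mul_div_mul_comm, poch_div_pocho hψ hα, poch_div_pocho hψ hβ, mul_one]
    ring
  have hsum : ∑ t : κ, α (t * l)⁻¹ * α⁻¹ (1 - (t * l)⁻¹) * (β t * (β⁻¹ * γ) (1 - t)) =
      ∑ t : κ, α⁻¹ (t * l - 1) * (β t * (β⁻¹ * γ) (1 - t)) := by
    refine Finset.sum_congr rfl fun t _ ↦ ?_
    by_cases ht : t = 0
    · simp [ht, MulChar.map_zero]
    · rw [MulChar.inv_mul_inv_one_sub_inv α (mul_ne_zero ht hl)]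
  rw [Fh, Finset.sum_congr rfl fun ν _ ↦ hterm ν, ← Finset.mul_sum,
    sum_jacobiSum_mul_jacobiSum_mul, hsum]
  set S := ∑ t : κ, α⁻¹ (t * l - 1) * (β t * (β⁻¹ * γ) (1 - t))
  set K := gSo ψ 1 / (gS ψ α * gS ψ α⁻¹) * (gSo ψ γ / (gS ψ β * gS ψ (β⁻¹ * γ)))
  linear_combination -(K * S) * inv_mul_cancel₀ hq

lemma Fh_zero (ψ : AddChar κ ℂ) {r s : ℕ} (A : Fin r → MulChar κ ℂ)
    (B : Fin s → MulChar κ ℂ) : Fh ψ A B 0 = 0 := by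
  simp [Fh, MulChar.map_zero]

/-- Pfaff transformation: for `α ≠ ε`, `α ≠ γ`, `β ≠ ε`, `β ≠ γ` and `λ ≠ 1`,
`F(α,β;γ;λ) = ᾱ(1-λ) · F(α,β̄γ;γ;λ/(λ-1))`. -/
theorem stmt_10 (ψ : AddChar κ ℂ) (hψ : ψ ≠ 1) (α β γ : MulChar κ ℂ)
    (hα1 : α ≠ 1) (hαγ : α ≠ γ) (hβ1 : β ≠ 1) (hβγ : β ≠ γ)
    (l : κ) (hl : l ≠ 1) :
    Fh ψ ![α, β] ![γ] l =
      α⁻¹ (1 - l) * Fh ψ ![α, β⁻¹ * γ] ![γ] (l / (l - 1)) := by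
  obtain rfl | hl0 := eq_or_ne l 0
  · simp [Fh_zero]
  have hl1 : l - 1 ≠ 0 := sub_ne_zero.mpr hl
  have hβγ' : β⁻¹ * γ ≠ γ := by simpa using hβ1
  have hinv : (β⁻¹ * γ)⁻¹ * γ = β := by simp
  rw [Fh_eq_sum hψ hα1 hβγ hl0, Fh_eq_sum hψ hα1 hβγ' (div_ne_zero hl0 hl1), hinv,
    mul_comm (gS ψ (β⁻¹ * γ)), mul_left_comm (α⁻¹ (1 - l))]
  congr 1
  rw [Finset.mul_sum, ← (Equiv.subLeft (1 : κ)).sum_comp]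
  refine Finset.sum_congr rfl fun t _ ↦ ?_
  rw [Equiv.subLeft_apply, sub_sub_cancel, ← mul_assoc (α⁻¹ (1 - l)), ← map_mul,
    show (1 - l) * (t * (l / (l - 1)) - 1) = (1 - t) * l - 1 by field_simp; ring]
  ring

end
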